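/- For every integer k ≥ 1, setting n = 2^k, and every integer t ≥ 1, there exists a finite directed acyclic graph G together with n designated distinct vertices v_1, …, v_n such that: G has at most n + t(n−1) vertices and at most 3tn(k+1) arcs; G admits a topological order in which v_1 < v_2 < ⋯ < v_n; and every pair of distinct vertices x, y of G satisfies min{d(x→y), d(y→x)} ≤ t+1. -/

import Mathlib

/-- `HasWalk E u v n`: there is a directed walk with `n` arcs from `u` to `v`. -/
def HasWalk {V : Type*} (E : V → V → Prop) : V → V → ℕ → Prop
  | u, v, 0 => u = v
  | u, v, n + 1 => ∃ w, E u w ∧ HasWalk E w v n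

/-- Directed shortest-path distance: the number of arcs in a shortest directed
path from `u` to `v`, and `∞` if there is no such path. -/
noncomputable def ddist {V : Type*} (E : V → V → Prop) (u v : V) : ℕ∞ :=
  ⨅ (n : ℕ) (_ : HasWalk E u v n), (n : ℕ∞)

/-- The midpoint of the dyadic interval of length `2 ^ (j + 1)` containing `x`. -/
def dyadicMid (j x : ℕ) : ℕ := x / 2 ^ (j + 1) * 2 ^ (j + 1) + 2 ^ j

theorem exists_dyadicMid_separating (k x y : ℕ) (h : x / 2 ^ k = y / 2 ^ k) (hxy : x < y) :
    ∃ j < k, dyadicMid j x = dyadicMid j y ∧ x < dyadicMid j x ∧ dyadicMid j y ≤ y := by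
  induction k with
  | zero => simp at h; omega
  | succ k ih =>
    by_cases hk : x / 2 ^ k = y / 2 ^ k
    · obtain ⟨j, hj, h'⟩ := ih hk
      exact ⟨j, by omega, h'⟩
    · refine ⟨k, by omega, by simp [dyadicMid, h], ?_⟩
      have hle : x / 2 ^ k ≤ y / 2 ^ k := Nat.div_le_div_right hxy.le
      have hpos : 0 < 2 ^ k := by positivity
      have hx := Nat.div_add_mod x (2 ^ k)
      have hy := Nat.div_add_mod y (2 ^ k)
      have hxm := Nat.mod_lt x hpos
      simp only [dyadicMid, pow_succ, ← Nat.div_div_eq_div_mul] at h ⊢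
      generalize x / 2 ^ k = p at *
      generalize y / 2 ^ k = q at *
      generalize 2 ^ k = c at *
      obtain rfl : q = p + 1 := by omega
      have hp : p = p / 2 * 2 := by omega
      have hm : p / 2 * (c * 2) = c * p := by
        conv_rhs => rw [hp]
        ring
      rw [← h, hm]
      rw [mul_add] at hy
      omega

theorem ddist_le_of_hasWalk {V : Type*} {E : V → V → Prop} {u v : V} {n : ℕ}
    (h : HasWalk E u v n) : ddist E u v ≤ n :=
  iInf₂_le n h

/-- Join each `x` to the midpoints of the dyadic intervals of length `2, …, 2 ^ k` containing it. -/
def dyadicArc (k : ℕ) (a b : Fin (2 ^ k)) : Prop :=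
  a < b ∧ ∃ j < k, (b : ℕ) = dyadicMid j a ∨ (a : ℕ) = dyadicMid j b

theorem ddist_dyadicArc_le_two {k : ℕ} {x y : Fin (2 ^ k)} (h : x < y) :
    ddist (dyadicArc k) x y ≤ 2 := by
  obtain ⟨j, hj, he, h₁, h₂⟩ := exists_dyadicMid_separating k x y
    (by rw [Nat.div_eq_of_lt x.2, Nat.div_eq_of_lt y.2]) h
  let m : Fin (2 ^ k) := ⟨dyadicMid j x, by omega⟩
  have hxm : dyadicArc k x m := ⟨h₁, j, hj, Or.inl rfl⟩
  rcases h₂.lt_or_eq with h₂ | h₂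
  · have hmy : dyadicArc k m y := ⟨by rw [← he] at h₂; exact h₂, j, hj, Or.inr he⟩
    exact ddist_le_of_hasWalk (n := 2) ⟨m, hxm, y, hmy, rfl⟩
  · have hm : m = y := Fin.ext (he.trans h₂)
    rw [hm] at hxm
    exact (ddist_le_of_hasWalk (n := 1) ⟨y, hxm, rfl⟩).trans (by norm_num)

theorem ncard_dyadicArc_le (k : ℕ) :
    {p : Fin (2 ^ k) × Fin (2 ^ k) | dyadicArc k p.1 p.2}.ncard ≤ 2 * (2 ^ k * k) := by
  let S := {p : Fin (2 ^ k) × Fin (2 ^ k) | dyadicArc k p.1 p.2}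
  let val : Fin (2 ^ k) × Fin (2 ^ k) → ℕ × ℕ := Prod.map Fin.val Fin.val
  let I := Finset.range (2 ^ k) ×ˢ Finset.range k
  let T : Finset (ℕ × ℕ) :=
    I.image (fun p => (p.1, dyadicMid p.2 p.1)) ∪ I.image (fun p => (dyadicMid p.2 p.1, p.1))
  have hsub : val '' S ⊆ T := by
    rintro _ ⟨⟨a, b⟩, ⟨-, j, hj, h | h⟩, rfl⟩
    · refine Finset.mem_union_left _ (Finset.mem_image.2 ⟨(a, j), ?_, ?_⟩)
      · simp [I, hj]
      · simpa [val] using h.symm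
    · refine Finset.mem_union_right _ (Finset.mem_image.2 ⟨(b, j), ?_, ?_⟩)
      · simp [I, hj]
      · simpa [val] using h.symm
  have hI : I.card = 2 ^ k * k := by simp [I]
  calc S.ncard = (val '' S).ncard :=
        (Set.ncard_image_of_injective S (Fin.val_injective.prodMap Fin.val_injective)).symm
    _ ≤ T.card := by
        rw [← Set.ncard_coe_finset]
        exact Set.ncard_le_ncard hsub T.finite_toSet
    _ ≤ I.card + I.card :=
        (Finset.card_union_le _ _).trans
          (Nat.add_le_add Finset.card_image_le Finset.card_image_le)
    _ = 2 * (2 ^ k * k) := by rw [hI]; ring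

/-- The gadget `DG_t(X)`: for every `k ≥ 1` (with `n = 2^k`) and `t ≥ 1` there is a
finite DAG with at most `n + t(n-1)` vertices and at most `3tn(k+1)` arcs,
presented in topological order (all arcs increase the index), containing `n`
designated distinct vertices `v_1 < ⋯ < v_n` in that order, such that every pair of
distinct vertices is at min-distance at most `t + 1`. -/
theorem stmt_12 (k t : ℕ) (hk : 1 ≤ k) (ht : 1 ≤ t) :
    ∃ (N : ℕ) (E : Fin N → Fin N → Prop) (v : Fin (2 ^ k) → Fin N),
      N ≤ 2 ^ k + t * (2 ^ k - 1) ∧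
      {p : Fin N × Fin N | E p.1 p.2}.ncard ≤ 3 * t * 2 ^ k * (k + 1) ∧
      (∀ a b : Fin N, E a b → a < b) ∧
      StrictMono v ∧
      (∀ x y : Fin N, x ≠ y →
        min (ddist E x y) (ddist E y x) ≤ ((t : ℕ∞) + 1)) := by
  refine ⟨2 ^ k, dyadicArc k, id, Nat.le_add_right _ _, ?_, fun _ _ h => h.1, strictMono_id, ?_⟩
  · calc _ ≤ 2 * (2 ^ k * k) := ncard_dyadicArc_le k
      _ = 2 * 1 * 2 ^ k * k := by ring
      _ ≤ 3 * t * 2 ^ k * (k + 1) := by gcongr <;> omega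
  · intro x y hxy
    have ht' : (2 : ℕ∞) ≤ t + 1 := by
      have : 2 ≤ t + 1 := by omega
      exact_mod_cast this
    rcases lt_or_gt_of_ne hxy with h | h
    · exact (min_le_left _ _).trans ((ddist_dyadicArc_le_two h).trans ht')
    · exact (min_le_right _ _).trans ((ddist_dyadicArc_le_two h).trans ht')
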